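/- Let κ ∈ (8/3,4), set q = 4·cos(πκ/4)² and ρ = −κ/2. Then −2 < ρ < κ − 4, sin(πρ/2) − sin(π(κ−ρ)/2) ≠ 0, and sin(πρ/2)/(sin(πρ/2) − sin(π(κ−ρ)/2)) = 1/q. -/

import Mathlib

theorem stmt_2 (κ q ρ : ℝ) (h1 : 8/3 < κ) (h2 : κ < 4)
    (hq : q = 4 * Real.cos (Real.pi * κ / 4) ^ 2)
    (hρ : ρ = -κ / 2) :
    -2 < ρ ∧ ρ < κ - 4 ∧
    Real.sin (Real.pi * ρ / 2) - Real.sin (Real.pi * (κ - ρ) / 2) ≠ 0 ∧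
    Real.sin (Real.pi * ρ / 2) /
      (Real.sin (Real.pi * ρ / 2) - Real.sin (Real.pi * (κ - ρ) / 2)) = 1/q := by
  subst hq hρ
  have hpi := Real.pi_pos
  have e1 : Real.pi * (-κ / 2) / 2 = -(Real.pi * κ / 4) := by ring
  have e2 : Real.pi * (κ - -κ / 2) / 2 = 3 * (Real.pi * κ / 4) := by ring
  rw [e1, e2, Real.sin_neg, Real.sin_three_mul]
  have hs : 0 < Real.sin (Real.pi * κ / 4) :=
    Real.sin_pos_of_pos_of_lt_pi (by positivity) (by nlinarith)
  have hc : Real.cos (Real.pi * κ / 4) < 0 :=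
    Real.cos_neg_of_pi_div_two_lt_of_lt (by nlinarith) (by nlinarith)
  have hsc := Real.sin_sq_add_cos_sq (Real.pi * κ / 4)
  generalize Real.sin (Real.pi * κ / 4) = s at *
  generalize Real.cos (Real.pi * κ / 4) = c at *
  have hd : -s - (3 * s - 4 * s ^ 3) = -s * (4 * c ^ 2) := by
    linear_combination 4 * s * hsc
  have hs' := hs.ne'
  have hc' := hc.ne
  rw [hd]
  refine ⟨by linarith, by linarith, by simp [hs', hc'], ?_⟩
  field_simp
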